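/- Let f ∈ ℂ[z₁,…,zₙ] be a nondegenerate quasi-homogeneous polynomial with weights q₁,…,qₙ, and set V(z) = |∂f(z)|² = ∑_{i=1}ⁿ |∂f/∂z_i(z)|². Let h ∈ ℂ[z₁,…,zₙ] be quasi-homogeneous with the same weights and charge c_h > 0, i.e. h(λ^{k₁}z₁,…,λ^{kₙ}zₙ) = λ^{d·c_h} h(z) for all λ ∈ ℂ (where q_i = k_i/d). Then for every multi-index α ∈ ℕⁿ with q·α = ∑_i q_i α_i ≤ c_h, there exists a constant C_α > 0 such that for all z ∈ ℂⁿ, |∂^α h(z)| ≤ C_α (V(z) + 1)^{c_h − q·α}. -/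

import Mathlib

open MvPolynomial

/-- `f ∈ ℂ[z₁,…,zₙ]` is quasi-homogeneous of degree `d` with integer weights `k i`
(so the rational weights are `q i = k i / d`). -/
def IsQuasiHomogeneous {n : ℕ} (f : MvPolynomial (Fin n) ℂ) (d : ℕ) (k : Fin n → ℕ) : Prop :=
  ∀ (lam : ℂ) (z : Fin n → ℂ),
    eval (fun i => lam ^ k i * z i) f = lam ^ d * eval z f

/-- `f` is nondegenerate: it contains no monomial `z_i z_j` with `i ≠ j`, and the origin is
an isolated critical point of `f`. -/
def Nondegenerate {n : ℕ} (f : MvPolynomial (Fin n) ℂ) : Prop :=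
  (∀ i j : Fin n, i ≠ j →
    coeff (Finsupp.single i 1 + Finsupp.single j 1) f = 0) ∧
  (∃ ε : ℝ, 0 < ε ∧ ∀ z : Fin n → ℂ, (∀ i, ‖z i‖ < ε) →
    (∀ i, eval z (pderiv i f) = 0) → z = 0)

/-- The iterated partial derivative `∂^α = (∂/∂z₁)^{α₁} ⋯ (∂/∂zₙ)^{αₙ}`. -/
noncomputable def pderivMulti {n : ℕ} (α : Fin n → ℕ) (h : MvPolynomial (Fin n) ℂ) :
    MvPolynomial (Fin n) ℂ :=
  (List.ofFn fun i : Fin n =>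
    ((pderiv (R := ℂ) i).toLinearMap ^ α i :
      MvPolynomial (Fin n) ℂ →ₗ[ℂ] MvPolynomial (Fin n) ℂ)).prod h

lemma aux_coeff_scale {n : ℕ} (c : Fin n → ℂ) (p : MvPolynomial (Fin n) ℂ) (s : Fin n →₀ ℕ) :
    coeff s (aeval (fun i => C (c i) * X i) p : MvPolynomial (Fin n) ℂ)
      = (∏ i, c i ^ s i) * coeff s p := by
  classical
  induction p using MvPolynomial.induction_on' with
  | add p q hp hq => rw [map_add, coeff_add, coeff_add, hp, hq, mul_add]
  | monomial u a =>
    have h1 : (aeval (fun i => C (c i) * X i) (monomial u a) : MvPolynomial (Fin n) ℂ)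
        = C (a * ∏ i, c i ^ u i) * monomial u 1 := by
      rw [aeval_monomial, Finsupp.prod_fintype _ _ (fun i => pow_zero _)]
      simp only [mul_pow, Finset.prod_mul_distrib, algebraMap_eq]
      rw [← mul_assoc, map_mul, map_prod]
      congr 1
      · simp
      · rw [monomial_eq, Finsupp.prod_fintype _ _ (fun i => pow_zero _)]
        simp
    rw [h1, coeff_C_mul, coeff_monomial, coeff_monomial]
    split_ifs with h
    · subst h; ring
    · simp

lemma aux_wh {n : ℕ} (f : MvPolynomial (Fin n) ℂ) (d : ℕ) (k : Fin n → ℕ)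
    (h : IsQuasiHomogeneous f d k) : IsWeightedHomogeneous k f d := by
  intro s hs
  have h1 : (aeval (fun i => C ((2:ℂ) ^ k i) * X i) f : MvPolynomial (Fin n) ℂ)
      = C ((2:ℂ) ^ d) * f := by
    apply MvPolynomial.funext
    intro z
    rw [map_mul, eval_C, ← h 2 z]
    have := MvPolynomial.induction_on (motive := fun p : MvPolynomial (Fin n) ℂ =>
      eval z (aeval (fun i => C ((2:ℂ) ^ k i) * X i) p : MvPolynomial (Fin n) ℂ)
        = eval (fun i => 2 ^ k i * z i) p) f (by intro a; simp)
        (by intro p q hp hq; simp only [map_add, hp, hq])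
        (by intro p i hp; simp only [map_mul, hp]; simp)
    exact this
  have h2 := congrArg (coeff s) h1
  rw [aux_coeff_scale, coeff_C_mul] at h2
  have h3 := mul_right_cancel₀ hs h2
  simp only [← pow_mul] at h3
  rw [Finset.prod_pow_eq_pow_sum] at h3
  have h4 : (2:ℕ) ^ (∑ i, k i * s i) = 2 ^ d := by exact_mod_cast h3
  have h5 := Nat.pow_right_injective (le_refl 2) h4
  rw [Finsupp.weight_eq_sum, ← h5]
  exact Finset.sum_congr rfl fun i _ => by simp [mul_comm]

lemma aux_eval_scale {n : ℕ} (p : MvPolynomial (Fin n) ℂ) (m : ℕ) (k : Fin n → ℕ)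
    (h : IsWeightedHomogeneous k p m) (t : ℂ) (z : Fin n → ℂ) :
    eval (fun i => t ^ k i * z i) p = t ^ m * eval z p := by
  rw [eval_eq', eval_eq', Finset.mul_sum]
  refine Finset.sum_congr rfl fun s hs => ?_
  have h1 := h (mem_support_iff.mp hs)
  rw [Finsupp.weight_eq_sum] at h1
  simp only [mul_pow, Finset.prod_mul_distrib, ← pow_mul]
  rw [Finset.prod_pow_eq_pow_sum, ← h1]
  simp only [smul_eq_mul, mul_comm (k _)]
  ring

lemma aux_bound {n : ℕ} (p : MvPolynomial (Fin n) ℂ) (m : ℕ) (k : Fin n → ℕ)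
    (h : IsWeightedHomogeneous k p m) :
    ∃ B : ℝ, 0 < B ∧ ∀ (R : ℝ) (z : Fin n → ℂ), 0 ≤ R → (∀ i, ‖z i‖ ≤ R ^ k i) →
      ‖eval z p‖ ≤ B * R ^ m := by
  refine ⟨∑ s ∈ p.support, ‖coeff s p‖ + 1, by positivity, fun R z hR hz => ?_⟩
  have : ‖eval z p‖ ≤ (∑ s ∈ p.support, ‖coeff s p‖) * R ^ m := by
    rw [eval_eq', Finset.sum_mul]
    refine norm_sum_le_of_le _ fun s hs => ?_
    have h1 := h (mem_support_iff.mp hs)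
    rw [Finsupp.weight_eq_sum] at h1
    rw [norm_mul]
    refine mul_le_mul_of_nonneg_left ?_ (norm_nonneg _)
    rw [norm_prod]
    calc ∏ i, ‖z i ^ s i‖ ≤ ∏ i, R ^ (k i * s i) := by
          refine Finset.prod_le_prod (fun i _ => norm_nonneg _) fun i _ => ?_
          rw [norm_pow, pow_mul]
          exact pow_le_pow_left₀ (norm_nonneg _) (hz i) _
      _ = R ^ m := by
          rw [Finset.prod_pow_eq_pow_sum, ← h1]
          simp only [smul_eq_mul, mul_comm (k _)]
  have h2 : 0 ≤ R ^ m := by positivity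
  linarith

lemma aux_pow {n : ℕ} (k : Fin n → ℕ) (i : Fin n) (a m : ℕ) (p : MvPolynomial (Fin n) ℂ)
    (h : IsWeightedHomogeneous k p (m + k i * a)) :
    IsWeightedHomogeneous k (((pderiv (R := ℂ) i).toLinearMap ^ a :
      MvPolynomial (Fin n) ℂ →ₗ[ℂ] MvPolynomial (Fin n) ℂ) p) m := by
  induction a generalizing p with
  | zero => simpa using h
  | succ a ih =>
    rw [pow_succ]
    refine ih _ ?_
    exact IsWeightedHomogeneous.pderiv h (by ring)

lemma aux_list {n : ℕ} (k α : Fin n → ℕ) (l : List (Fin n)) (m : ℕ)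
    (p : MvPolynomial (Fin n) ℂ)
    (h : IsWeightedHomogeneous k p (m + (l.map fun i => k i * α i).sum)) :
    IsWeightedHomogeneous k ((l.map fun i => ((pderiv (R := ℂ) i).toLinearMap ^ α i :
      MvPolynomial (Fin n) ℂ →ₗ[ℂ] MvPolynomial (Fin n) ℂ)).prod p) m := by
  induction l generalizing m with
  | nil => simpa using h
  | cons i l ih =>
    rw [List.map_cons, List.prod_cons]
    refine aux_pow k i (α i) m _ (ih _ ?_)
    simpa [add_assoc] using h

lemma aux_multi {n : ℕ} (k α : Fin n → ℕ) (m : ℕ) (p : MvPolynomial (Fin n) ℂ)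
    (h : IsWeightedHomogeneous k p (m + ∑ i, k i * α i)) :
    IsWeightedHomogeneous k (pderivMulti α p) m := by
  unfold pderivMulti
  rw [List.ofFn_eq_map]
  refine aux_list k α _ m p ?_
  rwa [← List.ofFn_eq_map, List.sum_ofFn]

lemma aux_half {n : ℕ} (f : MvPolynomial (Fin n) ℂ) (d : ℕ) (k : Fin n → ℕ)
    (hk1 : ∀ i, k i < d) (hf : IsWeightedHomogeneous k f d) (hnd : Nondegenerate f)
    (i : Fin n) : 2 * k i ≤ d := by
  classical
  by_contra hcon
  obtain ⟨hmon, ε, hε, hz⟩ := hnd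
  have key := hz (Pi.single i ((ε / 2 : ℝ) : ℂ)) (by
    intro j
    by_cases hj : j = i
    · subst hj
      rw [Pi.single_eq_same, Complex.norm_real, Real.norm_eq_abs, abs_of_pos (by linarith)]
      linarith
    · rw [Pi.single_eq_of_ne hj]; simpa using hε) (by
    intro j
    rw [eval_eq']
    refine Finset.sum_eq_zero fun s hs => ?_
    by_cases hs' : ∃ l, l ≠ i ∧ s l ≠ 0
    · obtain ⟨l, hl, hsl⟩ := hs'
      rw [Finset.prod_eq_zero (Finset.mem_univ l), mul_zero]
      rw [Pi.single_eq_of_ne hl, zero_pow hsl]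
    · push Not at hs'
      have hs1 : s = Finsupp.single i (s i) := by
        ext l
        by_cases hl : l = i
        · subst hl; simp
        · rw [hs' l hl, Finsupp.single_eq_of_ne hl]
      exfalso
      have hc := mem_support_iff.mp hs
      rw [coeff_pderiv] at hc
      have hc1 := left_ne_zero_of_mul hc
      have hw := hf hc1
      rw [hs1, map_add, Finsupp.weight_single, Finsupp.weight_single] at hw
      simp only [smul_eq_mul, one_mul] at hw
      have hj := hk1 j
      have hm : s i = 1 := by
        rcases Nat.lt_trichotomy (s i) 1 with h | h | h
        · have : s i = 0 := by omega
          rw [this] at hw; omega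
        · exact h
        · have : 2 * k i ≤ s i * k i := Nat.mul_le_mul_right _ h
          omega
      by_cases hij : i = j
      · subst hij; rw [hm] at hw; omega
      · rw [hs1, hm] at hc1
        exact hc1 (hmon i j hij))
  have := congrFun key i
  rw [Pi.single_eq_same, Pi.zero_apply] at this
  have h2 : ε / 2 = 0 := by exact_mod_cast this
  linarith

lemma aux_nonvanish {n : ℕ} (f : MvPolynomial (Fin n) ℂ) (d : ℕ) (k : Fin n → ℕ)
    (hk0 : ∀ i, 0 < k i) (hk1 : ∀ i, k i < d) (hf : IsWeightedHomogeneous k f d)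
    (hnd : Nondegenerate f) (w : Fin n → ℂ) (hw : ∀ i, eval w (pderiv i f) = 0) : w = 0 := by
  obtain ⟨-, ε, hε, hz⟩ := hnd
  set t : ℝ := min 1 (ε / (2 * (‖w‖ + 1))) with ht
  have hw0 : 0 ≤ ‖w‖ := norm_nonneg w
  have ht0 : 0 < t := lt_min one_pos (by positivity)
  have ht1 : t ≤ 1 := min_le_left _ _
  have ht2 : t * (2 * (‖w‖ + 1)) ≤ ε := by
    rw [← le_div_iff₀ (by positivity)]; exact min_le_right _ _
  have key := hz (fun i => (t : ℂ) ^ k i * w i) (by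
    intro i
    rw [norm_mul, norm_pow, Complex.norm_real, Real.norm_eq_abs, abs_of_pos ht0]
    have h1 : t ^ k i ≤ t := pow_le_of_le_one ht0.le ht1 (hk0 i).ne'
    have h2 : ‖w i‖ ≤ ‖w‖ := norm_le_pi_norm w i
    have h3 : t ^ k i * ‖w i‖ ≤ t * ‖w‖ := mul_le_mul h1 h2 (norm_nonneg _) ht0.le
    nlinarith [mul_nonneg ht0.le hw0]) (by
    intro i
    have hp : IsWeightedHomogeneous k (pderiv i f) (d - k i) :=
      IsWeightedHomogeneous.pderiv hf (by have := hk1 i; omega)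
    rw [aux_eval_scale _ _ _ hp, hw i, mul_zero])
  funext i
  have := congrFun key i
  simp only [Pi.zero_apply, mul_eq_zero] at this
  rcases this with h | h
  · exact absurd h (pow_ne_zero _ (by exact_mod_cast ht0.ne'))
  · exact h

lemma aux_V {n : ℕ} (f : MvPolynomial (Fin n) ℂ) (d : ℕ) (k : Fin n → ℕ)
    (hk0 : ∀ i, 0 < k i) (hk1 : ∀ i, k i < d) (hf : IsWeightedHomogeneous k f d)
    (hnd : Nondegenerate f) :
    ∃ c : ℝ, 0 < c ∧ ∀ z : Fin n → ℂ, ∃ R : ℝ, 1 ≤ R ∧ (∀ i, ‖z i‖ ≤ R ^ k i) ∧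
      c * R ^ d ≤ (∑ i, ‖eval z (pderiv i f)‖ ^ 2) + 1 := by
  have hcont : Continuous fun w : Fin n → ℂ => ∑ i, ‖eval w (pderiv i f)‖ ^ 2 :=
    continuous_finsetSum _ fun i _ => ((MvPolynomial.continuous_eval _).norm.pow 2)
  obtain ⟨c, hc, hmin⟩ := (isCompact_sphere (0 : Fin n → ℂ) 1).exists_forall_le'
    hcont.continuousOn (a := 0) (by
      intro w hw
      refine lt_of_le_of_ne (Finset.sum_nonneg fun i _ => by positivity) fun h0 => ?_
      have h1 := (Finset.sum_eq_zero_iff_of_nonneg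
        (fun i _ => sq_nonneg ‖eval w (pderiv i f)‖)).mp h0.symm
      have h2 := aux_nonvanish f d k hk0 hk1 hf hnd w (fun i => by
        have := h1 i (Finset.mem_univ i)
        simpa using this)
      rw [h2] at hw
      simp at hw)
  refine ⟨min c 1, lt_min hc one_pos, fun z => ?_⟩
  have hVnn : 0 ≤ ∑ i, ‖eval z (pderiv i f)‖ ^ 2 := Finset.sum_nonneg fun i _ => by positivity
  by_cases hz : ∀ i, ‖z i‖ ≤ 1
  · refine ⟨1, le_rfl, by simpa using hz, ?_⟩
    have : min c 1 ≤ 1 := min_le_right _ _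
    simp only [one_pow, mul_one]
    linarith
  push Not at hz
  obtain ⟨i₀, hi₀⟩ := hz
  haveI : Nonempty (Fin n) := ⟨i₀⟩
  obtain ⟨j, hj⟩ := Finite.exists_max fun i => ‖z i‖ ^ ((1 : ℝ) / k i)
  set R : ℝ := ‖z j‖ ^ ((1 : ℝ) / k j) with hR
  have hroot : ∀ i, (‖z i‖ ^ ((1 : ℝ) / k i)) ^ k i = ‖z i‖ := by
    intro i
    rw [one_div]
    exact Real.rpow_inv_natCast_pow (norm_nonneg _) (hk0 i).ne'
  have hR1 : 1 ≤ R := by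
    refine le_trans ?_ (hj i₀)
    exact Real.one_le_rpow hi₀.le (by positivity)
  have hR0 : 0 < R := by linarith
  have hzR : ∀ i, ‖z i‖ ≤ R ^ k i := fun i => by
    rw [← hroot i]
    exact pow_le_pow_left₀ (by positivity) (hj i) _
  refine ⟨R, hR1, hzR, ?_⟩
  set w : Fin n → ℂ := fun i => z i / (R : ℂ) ^ k i with hw
  have hRc : (R : ℂ) ≠ 0 := by exact_mod_cast hR0.ne'
  have hzw : z = fun i => (R : ℂ) ^ k i * w i := by
    funext i
    simp only [hw]
    field_simp
  have hnw : ∀ i, ‖w i‖ = ‖z i‖ / R ^ k i := fun i => by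
    simp only [hw]
    rw [norm_div, norm_pow, Complex.norm_real, Real.norm_eq_abs, abs_of_pos hR0]
  have hws : w ∈ Metric.sphere (0 : Fin n → ℂ) 1 := by
    rw [mem_sphere_zero_iff_norm]
    apply le_antisymm
    · rw [pi_norm_le_iff_of_nonneg zero_le_one]
      intro i
      rw [hnw, div_le_one (by positivity)]
      exact hzR i
    · refine le_trans ?_ (norm_le_pi_norm w j)
      rw [hnw, le_div_iff₀ (by positivity), one_mul]
      exact (hroot j).le
  have h1 := hmin w hws
  have h2 : R ^ d * ∑ i, ‖eval w (pderiv i f)‖ ^ 2 ≤ ∑ i, ‖eval z (pderiv i f)‖ ^ 2 := by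
    rw [Finset.mul_sum]
    refine Finset.sum_le_sum fun i _ => ?_
    have hp : IsWeightedHomogeneous k (pderiv i f) (d - k i) :=
      IsWeightedHomogeneous.pderiv hf (by have := hk1 i; omega)
    have hh := aux_half f d k hk1 hf hnd i
    rw [hzw, aux_eval_scale _ _ _ hp, norm_mul, norm_pow, Complex.norm_real, Real.norm_eq_abs,
      abs_of_pos hR0, mul_pow, ← pow_mul]
    refine mul_le_mul_of_nonneg_right ?_ (by positivity)
    exact pow_le_pow_right₀ hR1 (by omega)
  have h3 : min c 1 * R ^ d ≤ c * R ^ d :=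
    mul_le_mul_of_nonneg_right (min_le_left _ _) (by positivity)
  have h4 : R ^ d * c ≤ R ^ d * ∑ i, ‖eval w (pderiv i f)‖ ^ 2 :=
    mul_le_mul_of_nonneg_left h1 (by positivity)
  linarith


/-- If `f` is nondegenerate quasi-homogeneous with potential `V = |∂f|²` and `h` is
quasi-homogeneous with the same weights `q i = k i / d` and charge `c_h = e/d > 0`
(i.e. `h(λ^{k} z) = λ^{d c_h} h(z) = λ^e h(z)`), then for each multi-index `α`
with `q·α ≤ c_h` there is `C_α > 0` with
`|∂^α h(z)| ≤ C_α (V(z)+1)^{c_h − q·α}` for all `z`. -/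
theorem pderiv_potential_bound {n : ℕ} (f h : MvPolynomial (Fin n) ℂ)
    (d : ℕ) (k : Fin n → ℕ) (hd : 0 < d) (hk0 : ∀ i, 0 < k i) (hk1 : ∀ i, k i < d)
    (hQH : IsQuasiHomogeneous f d k) (hnd : Nondegenerate f)
    (V : (Fin n → ℂ) → ℝ) (hV : ∀ z, V z = ∑ i, ‖eval z (pderiv i f)‖ ^ 2)
    (e : ℕ) (he : 0 < e) (hQHh : IsQuasiHomogeneous h e k)
    (α : Fin n → ℕ) (hα : ∑ i, k i * α i ≤ e) :
    ∃ C : ℝ, 0 < C ∧ ∀ z : Fin n → ℂ,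
      ‖eval z (pderivMulti α h)‖ ≤
        C * (V z + 1) ^ (((e : ℝ) - ∑ i, (k i : ℝ) * α i) / d) := by
  have hf := aux_wh f d k hQH
  have hh := aux_wh h e k hQHh
  obtain ⟨m, hm⟩ := Nat.exists_eq_add_of_le' hα
  rw [hm] at hh
  obtain ⟨B, hB, hbd⟩ := aux_bound _ m k (aux_multi k α m h hh)
  obtain ⟨c, hc, hcV⟩ := aux_V f d k hk0 hk1 hf hnd
  have hexp : ((e : ℝ) - ∑ i, (k i : ℝ) * α i) / d = (m : ℝ) / d := by
    rw [hm]; push_cast; ring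
  rw [hexp]
  refine ⟨B * (c⁻¹) ^ ((m : ℝ) / d), by positivity, fun z => ?_⟩
  obtain ⟨R, hR1, hzR, hle⟩ := hcV z
  rw [← hV z] at hle
  have hR0 : 0 ≤ R := by linarith
  have hV1 : 0 ≤ V z + 1 := le_trans (by positivity) hle
  refine (hbd R z hR0 hzR).trans ?_
  rw [mul_assoc]
  refine mul_le_mul_of_nonneg_left ?_ hB.le
  rw [← Real.mul_rpow (by positivity) hV1]
  have h1 : R ^ d ≤ c⁻¹ * (V z + 1) := by
    rw [inv_mul_eq_div, le_div_iff₀ hc]; linarith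
  have h2 : R ^ m = (R ^ d) ^ ((m : ℝ) / d) := by
    rw [← Real.rpow_natCast R d, ← Real.rpow_mul hR0, ← Real.rpow_natCast R m]
    congr 1
    field_simp
  rw [h2]
  exact Real.rpow_le_rpow (by positivity) h1 (by positivity)
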